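/- Let X, W be countable sets, 𝒜 = 2^(X), φ an 𝒜-gauge on W with φ(w,w) = ∅, and (X, μ) a measured walls structure. Define the kernel κ̃ on W × X by κ̃((w₁,x₁),(w₂,x₂)) = μ({A ⊆ X : A ⊢ φ(w₁,w₂) ∪ {x₁,x₂}}). If a subset E ⊆ W × X is κ̃-bounded (i.e. κ̃ is bounded on E × E), then E is contained in {w ∈ W : φ(w,w′) ⊆ B} × B′ for some d_μ-bounded subsets B, B′ of X and some w′ ∈ W. Conversely, if d_μ is proper (every d_μ-ball in X is finite), then every subset of the form {w ∈ W : φ(w,w′) ⊆ B} × B′ with B, B′ d_μ-bounded is κ̃-bounded. -/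

import Mathlib

open MeasureTheory Function Set
open scoped ENNReal
/-- A Borel measure on the power set `2^X`, identified with `X → Bool` endowed with the
product topology (and its Borel σ-algebra). -/
noncomputable abbrev WallMeasure (X : Type*) := @MeasureTheory.Measure (X → Bool) (borel _)

/-- The pseudo-distance associated to a wall measure:
`d_μ(x,y) = μ {A | exactly one of x, y belongs to A}`. -/
def wallDist {X : Type*} (μ : WallMeasure X) (x y : X) : ℝ≥0∞ :=
  μ {A | A x ≠ A y}

/-- A measured walls structure: all wall pseudo-distances are finite. -/
def IsMWS {X : Type*} (μ : WallMeasure X) : Prop :=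
  ∀ x y : X, wallDist μ x y < ⊤

/-- Pushforward of wall measures. -/
noncomputable def wallMap {X Y : Type*} (f : (X → Bool) → (Y → Bool)) (μ : WallMeasure X) :
    WallMeasure Y :=
  @MeasureTheory.Measure.map _ _ (borel _) (borel _) f μ

/-- Left invariance of a wall measure on a group, for the action `(k·A)(x) = A(k⁻¹x)`. -/
def IsLeftInvariantWalls {K : Type*} [Group K] (μ : WallMeasure K) : Prop :=
  ∀ k : K, wallMap (fun A x => A (k⁻¹ * x)) μ = μ

/-- `A ⊢ F` : the half-space `A` cuts the subset `F`, i.e. `F` is neither contained in `A`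
nor in its complement. -/
def CutsB {X : Type*} (A : X → Bool) (F : Set X) : Prop :=
  (∃ x ∈ F, A x = true) ∧ (∃ x ∈ F, A x = false)
/-- The lifted kernel on `W × X`:
`κ̃((w₁,x₁),(w₂,x₂)) = μ {A | A ⊢ φ(w₁,w₂) ∪ {x₁,x₂}}`. -/
noncomputable def liftedKernel {X W : Type*} (φ : W → W → Finset X) (μ : WallMeasure X)
    (p q : W × X) : ℝ≥0∞ :=
  μ {A | CutsB A ((φ p.1 q.1 : Set X) ∪ {p.2, q.2})}

theorem wallDist_triangle {X : Type*} (μ : WallMeasure X) (x y z : X) :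
    wallDist μ x z ≤ wallDist μ x y + wallDist μ y z := by
  refine (measure_mono fun A hA => ?_).trans (measure_union_le _ _)
  by_contra h
  simp only [mem_union, mem_ofPred_eq, not_or, not_not] at h
  exact hA (h.1.trans h.2)

theorem wallDist_comm {X : Type*} (μ : WallMeasure X) (x y : X) :
    wallDist μ x y = wallDist μ y x := by
  simp only [wallDist, ne_comm]

theorem wallDist_le_measure_cutsB {X : Type*} (μ : WallMeasure X) {F : Set X} {x y : X}
    (hx : x ∈ F) (hy : y ∈ F) : wallDist μ x y ≤ μ {A | CutsB A F} := by
  refine measure_mono fun A hA => ?_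
  have hne : A x ≠ A y := hA
  cases hAx : A x
  · exact ⟨⟨y, hy, by simpa [hAx] using hne.symm⟩, ⟨x, hx, hAx⟩⟩
  · exact ⟨⟨x, hx, hAx⟩, ⟨y, hy, by simpa [hAx] using hne.symm⟩⟩

theorem CutsB.mono {X : Type*} {A : X → Bool} {F G : Set X} (h : CutsB A F) (hFG : F ⊆ G) :
    CutsB A G :=
  ⟨h.1.imp fun _ hx => ⟨hFG hx.1, hx.2⟩, h.2.imp fun _ hx => ⟨hFG hx.1, hx.2⟩⟩

theorem measure_cutsB_lt_top {X : Type*} {μ : WallMeasure X} (hμ : IsMWS μ) {F : Set X}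
    (hF : F.Finite) : μ {A | CutsB A F} < ⊤ := by
  have hsub : {A | CutsB A F} ⊆ ⋃ p ∈ F ×ˢ F, {A : X → Bool | A p.1 ≠ A p.2} := by
    rintro A ⟨⟨x, hx, hAx⟩, ⟨y, hy, hAy⟩⟩
    exact mem_biUnion (x := (x, y)) ⟨hx, hy⟩ (by simp [hAx, hAy])
  exact (measure_mono hsub).trans_lt
    (@measure_biUnion_lt_top _ _ (borel _) μ _ _ (hF.prod hF) fun p _ => hμ p.1 p.2)

theorem finite_of_wallDist_bounded {X : Type*} {μ : WallMeasure X}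
    (hproper : ∀ (x : X) (r : ℝ≥0∞), r ≠ ⊤ → {y : X | wallDist μ x y ≤ r}.Finite) {B : Set X}
    (hB : ∃ r : ℝ≥0∞, r ≠ ⊤ ∧ ∀ x ∈ B, ∀ y ∈ B, wallDist μ x y ≤ r) : B.Finite := by
  obtain ⟨r, hr, hB⟩ := hB
  obtain rfl | ⟨x, hx⟩ := B.eq_empty_or_nonempty
  · exact finite_empty
  · exact (hproper x r hr).subset (hB x hx)

open scoped Classical in
/-- **Proposition.** A `κ̃`-bounded subset of `W × X` is contained in
`{w | φ(w,w′) ⊆ B} × B′` for some `d_μ`-bounded subsets `B, B′` of `X` and some `w′ ∈ W`;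
conversely, if `d_μ` is proper, every such subset is `κ̃`-bounded. -/
theorem lifted_kernel_bounded_sets {X W : Type*} [Countable X] [Countable W] [Nonempty W]
    (φ : W → W → Finset X)
    (hsymm : ∀ w w', φ w w' = φ w' w)
    (htri : ∀ w w' w'', φ w w'' ⊆ φ w w' ∪ φ w' w'')
    (hdiag : ∀ w, φ w w = ∅)
    (μ : WallMeasure X) (hμ : IsMWS μ) :
    (∀ E : Set (W × X),
      (∃ R : ℝ≥0∞, R ≠ ⊤ ∧ ∀ p ∈ E, ∀ q ∈ E, liftedKernel φ μ p q ≤ R) →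
      ∃ (B B' : Set X) (w' : W),
        (∃ r : ℝ≥0∞, r ≠ ⊤ ∧ ∀ x ∈ B, ∀ y ∈ B, wallDist μ x y ≤ r) ∧
        (∃ r : ℝ≥0∞, r ≠ ⊤ ∧ ∀ x ∈ B', ∀ y ∈ B', wallDist μ x y ≤ r) ∧
        E ⊆ {p : W × X | (φ p.1 w' : Set X) ⊆ B ∧ p.2 ∈ B'}) ∧
    ((∀ (x : X) (r : ℝ≥0∞), r ≠ ⊤ → {y : X | wallDist μ x y ≤ r}.Finite) →
      ∀ (B B' : Set X) (w' : W),
        (∃ r : ℝ≥0∞, r ≠ ⊤ ∧ ∀ x ∈ B, ∀ y ∈ B, wallDist μ x y ≤ r) →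
        (∃ r : ℝ≥0∞, r ≠ ⊤ ∧ ∀ x ∈ B', ∀ y ∈ B', wallDist μ x y ≤ r) →
        ∃ R : ℝ≥0∞, R ≠ ⊤ ∧ ∀ p ∈ {p : W × X | (φ p.1 w' : Set X) ⊆ B ∧ p.2 ∈ B'},
          ∀ q ∈ {p : W × X | (φ p.1 w' : Set X) ⊆ B ∧ p.2 ∈ B'},
            liftedKernel φ μ p q ≤ R) := by
  constructor
  · rintro E ⟨R, hR, hE⟩
    obtain rfl | ⟨p₀, hp₀⟩ := E.eq_empty_or_nonempty
    · exact ⟨∅, ∅, Classical.arbitrary W, ⟨0, by simp⟩, ⟨0, by simp⟩, empty_subset _⟩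
    have hdist : ∀ p ∈ E, ∀ x ∈ φ p.1 p₀.1, wallDist μ x p₀.2 ≤ R := fun p hp x hx =>
      (wallDist_le_measure_cutsB μ (Or.inl hx) (by simp)).trans (hE p hp p₀ hp₀)
    refine ⟨{x | ∃ p ∈ E, x ∈ φ p.1 p₀.1}, Prod.snd '' E, p₀.1, ⟨R + R, by simp [hR], ?_⟩,
      ⟨R, hR, ?_⟩, fun p hp => ⟨fun x hx => ⟨p, hp, hx⟩, mem_image_of_mem _ hp⟩⟩
    · rintro x ⟨p, hp, hx⟩ y ⟨q, hq, hy⟩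
      refine (wallDist_triangle μ x p₀.2 y).trans (add_le_add (hdist p hp x hx) ?_)
      rw [wallDist_comm]
      exact hdist q hq y hy
    · rintro _ ⟨p, hp, rfl⟩ _ ⟨q, hq, rfl⟩
      exact (wallDist_le_measure_cutsB μ (by simp) (by simp)).trans (hE p hp q hq)
  · intro hproper B B' w' hB hB'
    have hfin : (B ∪ B').Finite :=
      (finite_of_wallDist_bounded hproper hB).union (finite_of_wallDist_bounded hproper hB')
    refine ⟨μ {A | CutsB A (B ∪ B')}, (measure_cutsB_lt_top hμ hfin).ne, ?_⟩
    rintro p ⟨hpB, hpB'⟩ q ⟨hqB, hqB'⟩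
    refine measure_mono fun A hA => CutsB.mono hA (union_subset_union (fun x hx => ?_) ?_)
    · obtain hx | hx := Finset.mem_union.mp (htri p.1 w' q.1 hx)
      · exact hpB hx
      · exact hqB (hsymm w' q.1 ▸ hx)
    · rintro x (rfl | rfl)
      exacts [hpB', hqB']
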